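/- (Radó's theorem in several variables) Let D be a domain in ℂⁿ and let f : D → ℂ be a continuous function that is holomorphic on D ∖ f⁻¹({0}). Then f is holomorphic on D. -/

import Mathlib

open Metric Set

lemma schwarz_bound {g : ℂ → ℂ} {δ C : ℝ} (hg : DifferentiableOn ℂ g (ball 0 δ))
    (hC : ∀ z ∈ ball (0:ℂ) δ, ‖g z‖ ≤ C) {z : ℂ} (hz : z ∈ ball (0:ℂ) δ) :
    ‖g z - g 0‖ ≤ 2 * C / δ * ‖z‖ := by
  have hδ : 0 < δ := nonempty_ball.mp ⟨_, hz⟩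
  have h0 := hC 0 (by simpa using hδ)
  have := Complex.dist_le_div_mul_dist_of_mapsTo_ball (R₂ := 2 * C) hg (fun w hw => by
    rw [mem_closedBall, dist_eq_norm]
    have := hC w hw
    linarith [norm_sub_le (g w) (g 0)]) hz
  simpa [dist_eq_norm] using this

/-- Locally bounded Gateaux-holomorphic functions are holomorphic. -/
lemma gateaux_holo {n : ℕ} (f : (Fin n → ℂ) → ℂ) (x : Fin n → ℂ) {r C : ℝ} (hr : 0 < r)
    (hb : ∀ y ∈ ball x r, ‖f y‖ ≤ C)
    (hG : ∀ a v : Fin n → ℂ, DifferentiableOn ℂ (fun ζ : ℂ => f (a + ζ • v))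
      {ζ | a + ζ • v ∈ ball x r}) : DifferentiableAt ℂ f x := by
  have hC : 0 ≤ C := (norm_nonneg _).trans (hb x (mem_ball_self hr))
  have hopen : ∀ a v : Fin n → ℂ, IsOpen {ζ : ℂ | a + ζ • v ∈ ball x r} := fun a v =>
    isOpen_ball.preimage (by fun_prop)
  have hd : ∀ v : Fin n → ℂ, DifferentiableAt ℂ (fun ζ : ℂ => f (x + ζ • v)) 0 := fun v =>
    (hG x v).differentiableAt ((hopen x v).mem_nhds (by simpa using hr))
  let L : (Fin n → ℂ) → ℂ := fun v => deriv (fun ζ : ℂ => f (x + ζ • v)) 0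
  have hL : ∀ v, HasDerivAt (fun ζ : ℂ => f (x + ζ • v)) (L v) 0 := fun v => (hd v).hasDerivAt
  have hsmul : ∀ (c : ℂ) v, L (c • v) = c * L v := by
    intro c v
    have h1 : HasDerivAt (fun ζ : ℂ => ζ * c) c 0 := by
      simpa using (hasDerivAt_id (0:ℂ)).mul_const c
    have h2 := HasDerivAt.comp (0:ℂ) (h := fun ζ : ℂ => ζ * c) (h₂ := fun ζ : ℂ => f (x + ζ • v))
      (h₂' := L v) (by simpa using hL v) h1
    have h3 : HasDerivAt (fun ζ : ℂ => f (x + ζ • (c • v))) (L v * c) 0 := by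
      have he : (fun ζ : ℂ => f (x + ζ • (c • v)))
          = (fun ζ : ℂ => f (x + ζ • v)) ∘ fun ζ : ℂ => ζ * c := by
        ext ζ
        simp [smul_smul]
      rw [he]
      exact h2
    rw [mul_comm]
    exact h3.deriv
  have hadd : ∀ v w, L (v + w) = L v + L w := by
    intro v w
    obtain ⟨δ, hδ, hδr⟩ : ∃ δ : ℝ, 0 < δ ∧ δ * (‖v‖ + ‖w‖) < r := by
      refine ⟨r / (‖v‖ + ‖w‖ + 1), by positivity, ?_⟩
      rw [div_mul_eq_mul_div, div_lt_iff₀ (by positivity)]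
      nlinarith
    have hmem : ∀ s ∈ ball (0:ℂ) δ, ∀ t ∈ ball (0:ℂ) δ, x + s • v + t • w ∈ ball x r := by
      intro s hs t ht
      rw [mem_ball_zero_iff] at hs ht
      rw [mem_ball, dist_eq_norm]
      calc ‖x + s • v + t • w - x‖ = ‖s • v + t • w‖ := by congr 1; abel
        _ ≤ ‖s‖ * ‖v‖ + ‖t‖ * ‖w‖ := (norm_add_le _ _).trans (by simp [norm_smul])
        _ ≤ δ * ‖v‖ + δ * ‖w‖ := by gcongr
        _ < r := by linarith
    have h0 : (0:ℂ) ∈ ball (0:ℂ) δ := mem_ball_self hδ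
    have h1 : ∀ s ∈ ball (0:ℂ) δ, ∀ t ∈ ball (0:ℂ) δ,
        ‖f (x + s • v + t • w) - f (x + s • v)‖ ≤ 2 * C / δ * ‖t‖ := by
      intro s hs t ht
      have := schwarz_bound (g := fun t : ℂ => f (x + s • v + t • w)) (δ := δ) (C := C)
        ((hG (x + s • v) w).mono fun t ht => hmem s hs t ht)
        (fun t ht => hb _ (hmem s hs t ht)) ht
      simpa using this
    have h2 : ∀ t ∈ ball (0:ℂ) δ,
        ‖f (x + t • (v + w)) - f (x + t • v) - f (x + t • w) + f x‖
          ≤ 4 * C / δ ^ 2 * ‖t‖ ^ 2 := by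
      intro t ht
      have := schwarz_bound
        (g := fun s : ℂ => f (x + s • v + t • w) - f (x + s • v)) (δ := δ)
        (C := 2 * C / δ * ‖t‖)
        (by
          refine DifferentiableOn.sub ?_ ?_
          · have := (hG (x + t • w) v).mono (s := ball 0 δ) fun s hs => by
              have := hmem s hs t ht
              rwa [add_right_comm] at this
            refine this.congr fun s hs => ?_
            simp only [add_right_comm]
          · exact (hG x v).mono fun s hs => by simpa using hmem s hs 0 h0)
        (fun s hs => h1 s hs t ht) ht
      simp only [zero_smul, add_zero] at this
      calc _ = ‖f (x + t • v + t • w) - f (x + t • v) - (f (x + t • w) - f x)‖ := by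
            congr 1; rw [smul_add, ← add_assoc]; ring
        _ ≤ _ := this
        _ = _ := by field_simp; ring
    have h3 : HasDerivAt (fun t : ℂ => f (x + t • (v + w)) - f (x + t • v) - f (x + t • w) + f x)
        (L (v + w) - L v - L w) 0 := (((hL (v + w)).sub (hL v)).sub (hL w)).add_const _
    have h4 : HasDerivAt (fun t : ℂ => f (x + t • (v + w)) - f (x + t • v) - f (x + t • w) + f x)
        0 0 := by
      rw [hasDerivAt_iff_isLittleO]
      have : (fun t : ℂ => f (x + t • (v + w)) - f (x + t • v) - f (x + t • w) + f x)
          =O[nhds 0] fun t : ℂ => t ^ 2 := by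
        refine Asymptotics.IsBigO.of_bound (4 * C / δ ^ 2) ?_
        filter_upwards [ball_mem_nhds (0:ℂ) hδ] with t ht
        simpa using h2 t ht
      simpa using this.trans_isLittleO (Asymptotics.isLittleO_pow_id (by norm_num))
    have := h3.unique h4
    linear_combination this
  let Ll : (Fin n → ℂ) →ₗ[ℂ] ℂ := ⟨⟨L, hadd⟩, hsmul⟩
  have key : ∀ v, ‖v‖ < r → ‖f (x + v) - f x - L v‖ ≤ 4 * C / r ^ 2 * ‖v‖ ^ 2 := by
    intro v hv
    by_cases hv0 : v = 0
    · have := hsmul 0 0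
      simp only [smul_zero, zero_mul] at this
      simp [hv0, this]
    have hvp : 0 < ‖v‖ := norm_pos_iff.mpr hv0
    have hmem : ∀ ζ ∈ ball (0:ℂ) (r / ‖v‖), x + ζ • v ∈ ball x r := by
      intro ζ hζ
      rw [mem_ball_zero_iff, lt_div_iff₀ hvp] at hζ
      simpa [dist_eq_norm, norm_smul] using hζ
    have h1 : (1:ℂ) ∈ ball (0:ℂ) (r / ‖v‖) := by
      rw [mem_ball_zero_iff, lt_div_iff₀ hvp]; simpa using hv
    have hR : 0 < r / ‖v‖ := by positivity
    have hdg : DifferentiableOn ℂ (fun ζ : ℂ => f (x + ζ • v)) (ball 0 (r / ‖v‖)) :=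
      (hG x v).mono hmem
    have hds : DifferentiableOn ℂ (dslope (fun ζ : ℂ => f (x + ζ • v)) 0) (ball 0 (r / ‖v‖)) :=
      (Complex.differentiableOn_dslope (ball_mem_nhds _ hR)).mpr hdg
    have hbd : ∀ z ∈ ball (0:ℂ) (r / ‖v‖),
        ‖dslope (fun ζ : ℂ => f (x + ζ • v)) 0 z‖ ≤ 2 * C / (r / ‖v‖) := by
      intro z hz
      refine Complex.norm_dslope_le_div_of_mapsTo_ball hdg (fun w hw => ?_) hz
      rw [mem_closedBall, dist_eq_norm]
      have e1 := hb _ (hmem w hw)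
      have e2 := hb _ (hmem 0 (mem_ball_self hR))
      linarith [norm_sub_le (f (x + w • v)) (f (x + (0:ℂ) • v))]
    have := schwarz_bound hds hbd h1
    rw [dslope_of_ne _ one_ne_zero, dslope_same] at this
    simp only [slope_def_field, one_smul, zero_smul, add_zero, sub_zero, div_one, norm_one] at this
    refine this.trans_eq ?_
    field_simp
    ring
  have : HasFDerivAt f (LinearMap.toContinuousLinearMap Ll) x := by
    rw [hasFDerivAt_iff_isLittleO_nhds_zero]
    have : (fun h => f (x + h) - f x - (LinearMap.toContinuousLinearMap Ll) h)
        =O[nhds 0] fun h => ‖h‖ ^ 2 := by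
      refine Asymptotics.IsBigO.of_bound (4 * C / r ^ 2) ?_
      filter_upwards [ball_mem_nhds (0 : Fin n → ℂ) hr] with h hh
      have := key h (by simpa using hh)
      simpa [Ll] using this
    exact this.trans_isLittleO (Asymptotics.isLittleO_norm_pow_id (by norm_num))
  exact this.differentiableAt

lemma frontier_meets {B s : Set ℂ} (hB : IsPreconnected B) (hs : IsClosed s)
    (h1 : (B ∩ s).Nonempty) (h2 : ¬ B ⊆ s) : (B ∩ frontier s).Nonempty := by
  by_contra h
  rw [not_nonempty_iff_eq_empty] at h
  obtain ⟨x, hxB, hxs⟩ := h1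
  obtain ⟨y, hyB, hys⟩ := not_subset.mp h2
  have hcov : B ⊆ interior s ∪ sᶜ := by
    intro z hz
    by_cases hzs : z ∈ s
    · left
      by_contra hzi
      have : z ∈ B ∩ frontier s := ⟨hz, by rw [hs.frontier_eq]; exact ⟨hzs, hzi⟩⟩
      rw [h] at this; exact this
    · right; exact hzs
  have hxi : x ∈ interior s := (hcov hxB).resolve_right (fun h => h hxs)
  obtain ⟨z, -, hz1, hz2⟩ := hB _ _ isOpen_interior hs.isOpen_compl hcov ⟨x, hxB, hxi⟩ ⟨y, hyB, hys⟩
  exact hz2 (interior_subset hz1)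

lemma omega_open {f : ℂ → ℂ} (hf : ContinuousOn f (closedBall 0 1)) :
    IsOpen (ball (0:ℂ) 1 \ f ⁻¹' {0}) := by
  have := (hf.mono ball_subset_closedBall).isOpen_inter_preimage isOpen_ball
    (isOpen_compl_singleton (x := (0:ℂ)))
  simpa [sdiff_eq] using this

lemma closure_omega {f : ℂ → ℂ} : closure (ball (0:ℂ) 1 \ f ⁻¹' {0}) ⊆ closedBall 0 1 :=
  closure_minimal (sdiff_subset.trans ball_subset_closedBall) isClosed_closedBall

lemma max_principle {f F : ℂ → ℂ} (hf : ContinuousOn f (closedBall 0 1))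
    (hF : DiffContOnCl ℂ F (ball (0:ℂ) 1 \ f ⁻¹' {0}))
    (h0 : ∀ z, f z = 0 → F z = 0) {M : ℝ} (hM : 0 ≤ M)
    (hS : ∀ z ∈ closure (ball (0:ℂ) 1 \ f ⁻¹' {0}), ‖z‖ = 1 → ‖F z‖ ≤ M) {z : ℂ}
    (hz : z ∈ ball (0:ℂ) 1 \ f ⁻¹' {0}) : ‖F z‖ ≤ M := by
  refine Complex.norm_le_of_forall_mem_frontier_norm_le (isBounded_ball.subset sdiff_subset) hF ?_
    (subset_closure hz)
  intro w hw
  rw [(omega_open hf).frontier_eq] at hw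
  by_cases hfw : f w = 0
  · simpa [h0 w hfw] using hM
  · refine hS w hw.1 ?_
    have h1 : ‖w‖ ≤ 1 := by simpa using closure_omega hw.1
    refine le_antisymm h1 ?_
    by_contra hlt
    exact hw.2 ⟨by simpa using hlt, hfw⟩

lemma omega_dense {f : ℂ → ℂ} (hf : ContinuousOn f (closedBall 0 1))
    (hol : DifferentiableOn ℂ f (ball 0 1 \ f ⁻¹' {0}))
    (hne : (ball (0:ℂ) 1 \ f ⁻¹' {0}).Nonempty) :
    ball (0:ℂ) 1 ⊆ closure (ball (0:ℂ) 1 \ f ⁻¹' {0}) := by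
  by_contra hcon
  set Ω := ball (0:ℂ) 1 \ f ⁻¹' {0} with hΩ
  obtain ⟨γ, hγB, hγ⟩ := frontier_meets (convex_ball (0:ℂ) 1).isPreconnected isClosed_closure
    (by obtain ⟨x, hx⟩ := hne; exact ⟨x, hx.1, subset_closure hx⟩) hcon
  rw [isClosed_closure.frontier_eq] at hγ
  rw [mem_ball_zero_iff] at hγB
  obtain ⟨ε, hε, hεe⟩ : ∃ ε : ℝ, 0 < ε ∧ 4 * ε = 1 - ‖γ‖ := ⟨(1 - ‖γ‖) / 4, by linarith, by ring⟩
  obtain ⟨α, hαΩ, hα⟩ := Metric.mem_closure_iff.mp hγ.1 ε hε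
  obtain ⟨β, hβ, hβΩ⟩ : ∃ β ∈ ball γ ε, β ∉ closure Ω := by
    by_contra! h
    exact hγ.2 (mem_interior.mpr ⟨ball γ ε, h, isOpen_ball, mem_ball_self hε⟩)
  obtain ⟨M, hM⟩ := (isCompact_closedBall (0:ℂ) 1).exists_bound_of_continuousOn hf
  have hM0 : 0 ≤ M := (norm_nonneg _).trans (hM 0 (by simp))
  have hne : ∀ z ∈ closure Ω, z - β ≠ 0 := by
    intro z hz h
    rw [sub_eq_zero] at h
    exact hβΩ (h ▸ hz)
  have key : ∀ n : ℕ, ‖f α‖ ≤ M * (2 / 3) ^ n := by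
    intro n
    have hF : DiffContOnCl ℂ (fun z => f z / (z - β) ^ n) Ω := by
      refine ⟨?_, ?_⟩
      · exact hol.div (by fun_prop) fun z hz => pow_ne_zero _ (hne z (subset_closure hz))
      · exact (hf.mono closure_omega).div (by fun_prop) fun z hz => pow_ne_zero _ (hne z hz)
    have := max_principle (M := M / (3 * ε) ^ n) hf hF (fun z hz => by simp [hz]) (by positivity)
      (fun z hz hz1 => by
        rw [norm_div, norm_pow]
        have hd : 3 * ε ≤ ‖z - β‖ := by
          have h1 : ‖β - γ‖ < ε := by simpa [dist_eq_norm] using hβ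
          have h2 : ‖z‖ ≤ ‖z - β‖ + ‖β - γ‖ + ‖γ‖ := by
            calc ‖z‖ = ‖(z - β) + (β - γ) + γ‖ := by congr 1; ring
              _ ≤ _ := norm_add₃_le
          linarith
        have := hM z (by simp [hz1])
        gcongr) hαΩ
    rw [norm_div, norm_pow] at this
    have hαβ : ‖α - β‖ ≤ 2 * ε := by
      rw [← dist_eq_norm]
      have h1 := dist_triangle α γ β
      rw [mem_ball, dist_comm] at hβ
      rw [dist_comm] at hα
      linarith
    have hpos : 0 < ‖α - β‖ := norm_pos_iff.mpr (hne α (subset_closure hαΩ))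
    rw [div_le_iff₀ (by positivity)] at this
    calc ‖f α‖ ≤ M / (3 * ε) ^ n * ‖α - β‖ ^ n := this
      _ ≤ M / (3 * ε) ^ n * (2 * ε) ^ n := by gcongr
      _ = M * (2 / 3) ^ n := by
        rw [div_mul_eq_mul_div, mul_div_assoc, ← div_pow, mul_div_mul_right _ _ hε.ne']
  have hlim : Filter.Tendsto (fun n : ℕ => M * (2 / 3 : ℝ) ^ n) Filter.atTop (nhds (M * 0)) :=
    (tendsto_pow_atTop_nhds_zero_of_lt_one (by norm_num) (by norm_num)).const_mul M
  rw [mul_zero] at hlim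
  have := ge_of_tendsto' hlim key
  exact hαΩ.2 (norm_le_zero_iff.mp this)

lemma re_max {f g : ℂ → ℂ} (hf : ContinuousOn f (closedBall 0 1))
    (hol : DifferentiableOn ℂ f (ball 0 1 \ f ⁻¹' {0}))
    (hg : ContinuousOn g (closedBall 0 1))
    (hgol : DifferentiableOn ℂ g (ball 0 1 \ f ⁻¹' {0})) {ε : ℝ}
    (hε : ∀ z, ‖z‖ = 1 → (g z).re ≤ ε) {z : ℂ} (hz : z ∈ ball (0:ℂ) 1 \ f ⁻¹' {0}) :
    (g z).re ≤ ε := by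
  obtain ⟨M, hM⟩ := (isCompact_closedBall (0:ℂ) 1).exists_bound_of_continuousOn hf
  have hM0 : 0 ≤ M := (norm_nonneg _).trans (hM 0 (by simp))
  have hfz : 0 < ‖f z‖ := norm_pos_iff.mpr hz.2
  by_contra! hlt
  have key : ∀ n : ℕ, Real.exp (n * ((g z).re - ε)) * ‖f z‖ ≤ M := by
    intro n
    have hF : DiffContOnCl ℂ (fun z => Complex.exp (n * (g z - ε)) * f z)
        (ball (0:ℂ) 1 \ f ⁻¹' {0}) := by
      refine ⟨?_, ?_⟩
      · exact DifferentiableOn.mul (by fun_prop) hol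
      · have h1 := hf.mono (closure_omega (f := f))
        have h2 := hg.mono (closure_omega (f := f))
        exact ContinuousOn.mul (by fun_prop) h1
    have := max_principle (M := M) hf hF (fun z hz => by simp [hz]) hM0
      (fun w hw hw1 => by
        have h1 := hM w (by simp [hw1])
        have h2 : Real.exp (n * ((g w).re - ε)) ≤ 1 := by
          rw [Real.exp_le_one_iff]
          exact mul_nonpos_of_nonneg_of_nonpos (by positivity) (by linarith [hε w hw1])
        rw [norm_mul, Complex.norm_exp]
        have : ((n:ℂ) * (g w - ε)).re = n * ((g w).re - ε) := by simp
        rw [this]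
        calc _ ≤ 1 * M := by gcongr
          _ = M := one_mul M) hz
    rw [norm_mul, Complex.norm_exp] at this
    simpa using this
  obtain ⟨n, hn⟩ := exists_nat_gt (M / ‖f z‖ / ((g z).re - ε))
  have hd : 0 < (g z).re - ε := by linarith
  rw [div_lt_iff₀ hd, div_lt_iff₀ hfz] at hn
  have := key n
  have h2 := Real.add_one_le_exp (n * ((g z).re - ε))
  nlinarith

lemma circle_approx {u : ℂ → ℝ} (hu : ContinuousOn u (sphere 0 1)) {ε : ℝ} (hε : 0 < ε) :
    ∃ p : ℂ → ℂ, Differentiable ℂ p ∧ ∀ z, ‖z‖ = 1 → |(p z).re - u z| ≤ ε := by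
  have key : ∀ g ∈ Submodule.span ℂ (range (fourier (T := (1:ℝ)))), ∀ c : ℂ,
      ∃ p : ℂ → ℂ, Differentiable ℂ p ∧
        ∀ x : AddCircle (1:ℝ), (c * g x).re = (p (AddCircle.toCircle x : ℂ)).re := by
    intro g hg
    induction hg using Submodule.span_induction with
    | mem g hg =>
      obtain ⟨n, rfl⟩ := hg
      intro c
      rcases Int.eq_nat_or_neg n with ⟨m, rfl | rfl⟩
      · refine ⟨fun z => c * z ^ m, by fun_prop, fun x => ?_⟩
        simp [AddCircle.toCircle_nsmul]
      · refine ⟨fun z => (starRingEnd ℂ c) * z ^ m, by fun_prop, fun x => ?_⟩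
        rw [fourier_neg, fourier_apply, natCast_zsmul, AddCircle.toCircle_nsmul]
        rw [← Complex.conj_re]
        simp only [map_mul, Complex.conj_conj, Circle.coe_pow]
    | zero => exact fun c => ⟨fun _ => 0, by fun_prop, fun x => by simp⟩
    | add g₁ g₂ _ _ h1 h2 =>
      intro c
      obtain ⟨p, hp, hp'⟩ := h1 c
      obtain ⟨q, hq, hq'⟩ := h2 c
      refine ⟨fun z => p z + q z, hp.add hq, fun x => ?_⟩
      rw [Complex.add_re, ← hp', ← hq', ← Complex.add_re, ← mul_add]
      rfl
    | smul a g _ h =>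
      intro c
      obtain ⟨p, hp, hp'⟩ := h (c * a)
      refine ⟨p, hp, fun x => ?_⟩
      rw [← hp', mul_assoc]
      rfl
  let U : C(AddCircle (1:ℝ), ℂ) :=
    ⟨fun x => ((u (AddCircle.toCircle x : ℂ) : ℝ) : ℂ), by
      refine Complex.continuous_ofReal.comp ?_
      refine hu.comp_continuous
        (continuous_subtype_val.comp AddCircle.continuous_toCircle) fun x => ?_
      rw [mem_sphere_zero_iff_norm]
      exact Circle.norm_coe _⟩
  have hU : U ∈ (Submodule.span ℂ (range (fourier (T := (1:ℝ))))).topologicalClosure := by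
    rw [span_fourier_closure_eq_top]; trivial
  obtain ⟨g, hg, hgU⟩ := Metric.mem_closure_iff.mp hU ε hε
  obtain ⟨p, hp, hp'⟩ := key g hg 1
  refine ⟨p, hp, fun z hz => ?_⟩
  let zc : Circle := ⟨z, by simpa [Submonoid.unitSphere] using hz⟩
  obtain ⟨x, hx⟩ := (AddCircle.homeomorphCircle (T := (1:ℝ)) one_ne_zero).surjective zc
  rw [AddCircle.homeomorphCircle_apply] at hx
  have hxz : (AddCircle.toCircle x : ℂ) = z := by rw [hx]
  have h1 := (ContinuousMap.dist_apply_le_dist (f := U) (g := g) x).trans hgU.le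
  rw [dist_comm, dist_eq_norm] at h1
  have h2 := (Complex.abs_re_le_norm _).trans h1
  have h3 := hp' x
  rw [hxz, one_mul] at h3
  rw [Complex.sub_re, h3] at h2
  simpa [U, hxz] using h2

/-- The Herglotz integral of continuous boundary data. -/
lemma herglotz {u : ℂ → ℝ} (hu : ContinuousOn u (sphere 0 1)) :
    ∃ H : ℂ → ℂ, DifferentiableOn ℂ H (ball 0 1) ∧
      ∀ (p : ℂ → ℂ) (ε : ℝ), Differentiable ℂ p → (∀ z, ‖z‖ = 1 → |(p z).re - u z| ≤ ε) →
        ∀ w ∈ ball (0:ℂ) 1, |(p w).re - (H w).re| ≤ ε := by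
  have hcu : CircleIntegrable u 0 1 := ContinuousOn.circleIntegrable (by norm_num) hu
  have hcu' : CircleIntegrable (fun ζ => (u ζ : ℂ)) 0 1 :=
    ContinuousOn.circleIntegrable (by norm_num) (Complex.continuous_ofReal.comp_continuousOn hu)
  refine ⟨_, differentiableOn_circleAverage_herglotzRieszKernel_smul hcu', ?_⟩
  intro p ε hp hpu w hw
  rw [re_circleAverage_herglotzRieszKernel_smul hcu hw]
  set P : ℂ → ℝ := Complex.re ∘ herglotzRieszKernel 0 w with hP
  have hPc : ContinuousOn P (sphere 0 1) := by
    have := continuousOn_herglotzRieszKernel_sphere hw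
    rw [abs_one] at this
    exact Complex.continuous_re.comp_continuousOn this
  have hP0 : ∀ z ∈ sphere (0:ℂ) 1, 0 ≤ P z := by
    intro z hz
    have := le_re_herglotzRieszKernel hz hw
    refine le_trans ?_ this
    have : ‖w - 0‖ < 1 := by simpa using hw
    exact div_nonneg (by linarith) (by positivity)
  have hrep : ∀ q : ℂ → ℂ, Differentiable ℂ q →
      Real.circleAverage (fun z => P z * (q z).re) 0 1 = (q w).re := by
    intro q hq
    have h1 := (hq.diffContOnCl (s := ball 0 1)).circleAverage_re_herglotzRieszKernel_smul hw
    rw [← h1]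
    have hInt : CircleIntegrable (P • q) 0 1 :=
      ContinuousOn.circleIntegrable (by norm_num) (hPc.smul hq.continuous.continuousOn)
    have h2 := Complex.reCLM.circleAverage_comp_comm hInt
    rw [← Complex.reCLM_apply, ← h2]
    congr 1
    ext z
    simp
  have hInt : ∀ q : ℂ → ℂ, Differentiable ℂ q → CircleIntegrable (fun z => P z * (q z).re) 0 1 :=
    fun q hq => ContinuousOn.circleIntegrable (by norm_num)
      (hPc.mul (Complex.continuous_re.comp hq.continuous).continuousOn)
  have hIntu : CircleIntegrable (P • u) 0 1 :=
    ContinuousOn.circleIntegrable (by norm_num) (hPc.smul hu)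
  have hq1 : Differentiable ℂ (fun z => p z + ε) := by fun_prop
  have hq2 : Differentiable ℂ (fun z => p z - ε) := by fun_prop
  have e1 := hrep _ hq1
  have e2 := hrep _ hq2
  have m1 := Real.circleAverage_mono hIntu (hInt _ hq1) fun z hz => by
    rw [abs_one] at hz
    have h1 := hpu z (by simpa using hz)
    have h2 := hP0 z hz
    rw [abs_le] at h1
    simp only [Pi.smul_apply', smul_eq_mul, Complex.add_re, Complex.ofReal_re]
    exact mul_le_mul_of_nonneg_left (by linarith) h2
  have m2 := Real.circleAverage_mono (hInt _ hq2) hIntu fun z hz => by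
    rw [abs_one] at hz
    have h1 := hpu z (by simpa using hz)
    have h2 := hP0 z hz
    rw [abs_le] at h1
    simp only [Pi.smul_apply', smul_eq_mul, Complex.sub_re, Complex.ofReal_re]
    exact mul_le_mul_of_nonneg_left (by linarith) h2
  rw [e1] at m1
  rw [e2] at m2
  simp only [Complex.add_re, Complex.sub_re, Complex.ofReal_re] at m1 m2
  rw [abs_le]
  constructor <;> linarith

lemma re_eq_holo {f g : ℂ → ℂ} (hf : ContinuousOn f (closedBall 0 1))
    (hol : DifferentiableOn ℂ f (ball 0 1 \ f ⁻¹' {0}))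
    (hg : ContinuousOn g (closedBall 0 1))
    (hgol : DifferentiableOn ℂ g (ball 0 1 \ f ⁻¹' {0})) :
    ∃ H : ℂ → ℂ, DifferentiableOn ℂ H (ball 0 1) ∧
      ∀ z ∈ ball (0:ℂ) 1 \ f ⁻¹' {0}, (g z).re = (H z).re := by
  have hu : ContinuousOn (fun z => (g z).re) (sphere 0 1) :=
    Complex.continuous_re.comp_continuousOn (hg.mono sphere_subset_closedBall)
  obtain ⟨H, hH, hHp⟩ := herglotz hu
  refine ⟨H, hH, fun z hz => ?_⟩
  have key : ∀ ε : ℝ, 0 < ε → |(g z).re - (H z).re| ≤ 2 * ε := by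
    intro ε hε
    obtain ⟨p, hp, hpu⟩ := circle_approx hu hε
    have h1 := hHp p ε hp hpu z hz.1
    have h2 := re_max (g := fun z => p z - g z) (ε := ε) hf hol
      (hp.continuous.continuousOn.sub hg) (hp.differentiableOn.sub hgol)
      (fun w hw => by simpa using (abs_le.mp (hpu w hw)).2) hz
    have h3 := re_max (g := fun z => g z - p z) (ε := ε) hf hol
      (hg.sub hp.continuous.continuousOn) (hgol.sub hp.differentiableOn)
      (fun w hw => by have := (abs_le.mp (hpu w hw)).1; simp only [Complex.sub_re]; linarith) hz
    simp only [Complex.sub_re] at h2 h3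
    rw [abs_le] at h1 ⊢
    constructor <;> linarith [h1.1, h1.2]
  by_contra hne
  have hpos : 0 < |(g z).re - (H z).re| := abs_pos.mpr (sub_ne_zero.mpr hne)
  have := key (|(g z).re - (H z).re| / 4) (by positivity)
  linarith

lemma rado_disc {f : ℂ → ℂ} (hf : ContinuousOn f (closedBall 0 1))
    (hol : DifferentiableOn ℂ f (ball 0 1 \ f ⁻¹' {0})) : DifferentiableOn ℂ f (ball 0 1) := by
  by_cases hne : (ball (0:ℂ) 1 \ f ⁻¹' {0}).Nonempty
  swap
  · rw [not_nonempty_iff_eq_empty, sdiff_eq_empty] at hne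
    exact (differentiableOn_const (0:ℂ)).congr fun z hz => hne hz
  obtain ⟨H, hH, hfH⟩ := re_eq_holo hf hol hf hol
  obtain ⟨K, hK, hfK⟩ := re_eq_holo (g := fun z => -Complex.I * f z) hf hol
    (hf.const_smul (-Complex.I)) (hol.const_mul (-Complex.I))
  have hdense := omega_dense hf hol hne
  have hfb : ContinuousOn f (ball 0 1) := hf.mono ball_subset_closedBall
  have hext : ∀ u v : ℂ → ℝ, ContinuousOn u (ball 0 1) → ContinuousOn v (ball 0 1) →
      (∀ z ∈ ball (0:ℂ) 1 \ f ⁻¹' {0}, u z = v z) → ∀ z ∈ ball (0:ℂ) 1, u z = v z := by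
    intro u v hu hv huv
    exact EqOn.of_subset_closure huv hu hv sdiff_subset hdense
  have e1 : ∀ z ∈ ball (0:ℂ) 1, (f z).re = (H z).re :=
    hext _ _ (Complex.continuous_re.comp_continuousOn hfb)
      (Complex.continuous_re.comp_continuousOn hH.continuousOn) hfH
  have e2 : ∀ z ∈ ball (0:ℂ) 1, (f z).im = (K z).re :=
    hext _ _ (Complex.continuous_im.comp_continuousOn hfb)
      (Complex.continuous_re.comp_continuousOn hK.continuousOn) (by simpa using hfK)
  obtain ⟨z₀, hz₀⟩ := hne
  obtain ⟨r, hr, hrs⟩ := Metric.isOpen_iff.mp (omega_open hf) z₀ hz₀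
  have hconn : IsConnected (ball z₀ r) := ⟨⟨z₀, mem_ball_self hr⟩, (convex_ball _ _).isPreconnected⟩
  obtain ⟨a, ha⟩ := AnalyticOnNhd.eq_const_of_re_eq_const (f := fun z => f z - H z) (c₀ := 0)
    (((hol.mono hrs).sub (hH.mono (hrs.trans sdiff_subset))).analyticOnNhd isOpen_ball)
    (fun z hz => by simp [e1 z (hrs hz).1]) isOpen_ball hconn
  obtain ⟨b, hb⟩ := AnalyticOnNhd.eq_const_of_re_eq_const (f := fun z => -Complex.I * f z - K z)
    (c₀ := 0)
    ((((hol.mono hrs).const_mul _).sub (hK.mono (hrs.trans sdiff_subset))).analyticOnNhd isOpen_ball)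
    (fun z hz => by simp [e2 z (hrs hz).1]) isOpen_ball hconn
  have hHK : EqOn (fun z => H z - Complex.I * K z) (fun _ => Complex.I * b - a) (ball 0 1) := by
    refine AnalyticOnNhd.eqOn_of_preconnected_of_eventuallyEq
      ((hH.sub (hK.const_mul _)).analyticOnNhd isOpen_ball) analyticOnNhd_const
      (convex_ball _ _).isPreconnected hz₀.1 ?_
    filter_upwards [ball_mem_nhds z₀ hr] with z hz
    have h1 := ha z hz
    have h2 := hb z hz
    linear_combination -h1 + Complex.I * h2 + f z * Complex.I_sq
  set k := Complex.I * b - a with hk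
  have : EqOn f (fun z => H z - Complex.I * k.im) (ball 0 1) := by
    intro z hz
    have h1 := hHK hz
    simp only at h1
    have h2 := congrArg Complex.im h1
    simp at h2
    apply Complex.ext
    · simp [e1 z hz]
    · simp [e2 z hz]; linarith
  exact (hH.sub_const _).congr this

lemma rado_one {D : Set ℂ} (hD : IsOpen D) {f : ℂ → ℂ} (hf : ContinuousOn f D)
    (hol : DifferentiableOn ℂ f (D \ f ⁻¹' {0})) : DifferentiableOn ℂ f D := by
  intro c hc
  obtain ⟨r, hr, hrD⟩ := Metric.nhds_basis_closedBall.mem_iff.mp (hD.mem_nhds hc)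
  have hm : ∀ z ∈ closedBall (0:ℂ) 1, c + r * z ∈ D := by
    intro z hz
    apply hrD
    rw [mem_closedBall_zero_iff] at hz
    simp only [mem_closedBall, dist_eq_norm, add_sub_cancel_left, norm_mul, Complex.norm_real,
      Real.norm_eq_abs, abs_of_pos hr]
    nlinarith
  have h := rado_disc (f := fun z => f (c + r * z)) (hf.comp (by fun_prop) hm)
    (hol.comp (by fun_prop) fun z hz => ⟨hm z (ball_subset_closedBall hz.1), hz.2⟩)
  have h0 := h.differentiableAt (ball_mem_nhds (0:ℂ) one_pos)
  have hr' : (r:ℂ) ≠ 0 := by exact_mod_cast hr.ne'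
  have h1 : DifferentiableAt ℂ ((fun z => f (c + r * z)) ∘ fun w => (w - c) / r) c :=
    DifferentiableAt.comp c (by simpa using h0) (by fun_prop)
  have h2 : ((fun z => f (c + r * z)) ∘ fun w => (w - c) / r) = f := by
    ext w
    simp only [Function.comp]
    congr 1
    field_simp
    ring
  rw [h2] at h1
  exact h1.differentiableWithinAt

/-- **Radó's theorem in several variables.** A continuous function on a domain `D ⊆ ℂⁿ`
which is holomorphic off its zero set is holomorphic on `D`. -/
theorem rado_theorem
    {n : ℕ} (D : Set (Fin n → ℂ))
    (hDopen : IsOpen D) (hDconn : IsConnected D)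
    (f : (Fin n → ℂ) → ℂ) (hf : ContinuousOn f D)
    (hol : DifferentiableOn ℂ f (D \ f ⁻¹' {0})) :
    DifferentiableOn ℂ f D := by
  intro x hx
  refine DifferentiableAt.differentiableWithinAt ?_
  obtain ⟨r, hr, hrD⟩ := Metric.nhds_basis_closedBall.mem_iff.mp (hDopen.mem_nhds hx)
  obtain ⟨C, hC⟩ := (isCompact_closedBall x r).exists_bound_of_continuousOn (hf.mono hrD)
  have hbD : ball x r ⊆ D := ball_subset_closedBall.trans hrD
  refine gateaux_holo f x hr (fun y hy => hC y (ball_subset_closedBall hy)) fun a v => ?_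
  refine rado_one (isOpen_ball.preimage (by fun_prop)) ?_ ?_
  · exact hf.comp (f := fun ζ : ℂ => a + ζ • v) (by fun_prop) fun ζ hζ => hbD hζ
  · exact hol.comp (f := fun ζ : ℂ => a + ζ • v) (by fun_prop) fun ζ hζ => ⟨hbD hζ.1, hζ.2⟩
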